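/- arXiv:0806.3243 — 5 statements merged into one kernel-verified Lean document; each statement's English description precedes it below -/
import Mathlib

section
/- Let λ and ρ be degree-distribution polynomials and let p ∈ (0,1]. Define f(x) = p·λ(1−ρ(1−x)). If f(x) < x for all x ∈ (0,1] and moreover p·λ′(0)·ρ′(1) < 1, then sup_{x∈(0,1]} f(x)/x < 1. -/
/-- If `p·λ(1-ρ(1-x)) < x` on `(0,1]` and the stability condition
`p·λ'(0)·ρ'(1) < 1` holds, then `sup_{x ∈ (0,1]} p·λ(1-ρ(1-x))/x < 1`. -/
theorem de_sup_ratio_lt_one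
    (lam rho : Polynomial ℝ)
    (hlam_nonneg : ∀ n, 0 ≤ lam.coeff n)
    (hrho_nonneg : ∀ n, 0 ≤ rho.coeff n)
    (hlam0 : lam.eval 0 = 0) (hlam1 : lam.eval 1 = 1)
    (hrho0 : rho.eval 0 = 0) (hrho1 : rho.eval 1 = 1)
    (p : ℝ) (hp : p ∈ Set.Ioc (0:ℝ) 1)
    (f : ℝ → ℝ) (hf : ∀ t, f t = p * lam.eval (1 - rho.eval (1 - t)))
    (hthresh : ∀ t ∈ Set.Ioc (0:ℝ) 1, f t < t)
    (hstab : p * lam.derivative.eval 0 * rho.derivative.eval 1 < 1) :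
    sSup ((fun t => f t / t) '' Set.Ioc (0:ℝ) 1) < 1 := by
  obtain ⟨F, hF⟩ : ∃ F : Polynomial ℝ, F = Polynomial.C p *
      lam.comp (1 - rho.comp (1 - Polynomial.X)) := ⟨_, rfl⟩
  have hFe : ∀ t, F.eval t = f t := by
    intro t
    simp [hF, hf]
  have hF0 : F.coeff 0 = 0 := by
    rw [Polynomial.coeff_zero_eq_eval_zero, hFe, hf]
    simp [hrho1, hlam0]
  have hG : ∀ t, f t = F.divX.eval t * t := by
    intro t
    have h := congrArg (Polynomial.eval t) (Polynomial.divX_mul_X_add F)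
    rw [← hFe, ← h]
    simp [hF0]
  have hG0 : F.divX.eval 0 < 1 := by
    have h1 : F.divX.eval 0 = F.derivative.eval 0 := by
      rw [← Polynomial.coeff_zero_eq_eval_zero, ← Polynomial.coeff_zero_eq_eval_zero,
        Polynomial.coeff_divX, Polynomial.coeff_derivative]
      simp
    have h2 : F.derivative.eval 0 = p * lam.derivative.eval 0 * rho.derivative.eval 1 := by
      simp [hF, Polynomial.derivative_comp, hrho1]
      ring
    rw [h1, h2]
    exact hstab
  obtain ⟨m, hm, hmax⟩ := (isCompact_Icc (a := (0:ℝ)) (b := 1)).exists_isMaxOn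
    ⟨0, by simp⟩ (F.divX.continuous.continuousOn)
  have hm1 : F.divX.eval m < 1 := by
    rcases hm.1.eq_or_lt with h | h
    · rw [← h]; exact hG0
    · have h3 := hthresh m ⟨h, hm.2⟩
      rw [hG] at h3
      by_contra hc
      push Not at hc
      nlinarith
  refine lt_of_le_of_lt (csSup_le ⟨_, Set.mem_image_of_mem _ (show (1:ℝ) ∈ Set.Ioc (0:ℝ) 1 by simp)⟩ ?_) hm1
  rintro _ ⟨t, ht, rfl⟩
  have h4 : f t / t = F.divX.eval t := by
    rw [hG, mul_div_cancel_right₀ _ ht.1.ne']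
  simp only [h4]
  exact hmax ⟨ht.1.le, ht.2⟩
end

section
/- Let λ and ρ be degree-distribution polynomials and let p ∈ (0,1]. Define the coupled sequences x₀ = y₀ = 1, x_{i+1} = p·λ(1−ρ(1−x_i)), and y_{i+1} = λ(1−ρ(1−x_i)) + p·(ρ(1−x_i) − ρ(1−y_i))·λ′(1−ρ(1−x_i)). Then for every i ≥ 0 one has x_i ≤ y_i ≤ 1. -/
theorem aux_pow (a b : ℝ) (ha : 0 ≤ a) (hb : 0 ≤ b) (n : ℕ) :
    a ^ n + (b - a) * (n * a ^ (n - 1)) ≤ b ^ n := by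
  induction n with
  | zero => simp
  | succ n ih =>
    have h1 := mul_le_mul_of_nonneg_right ih hb
    have h2 : 0 ≤ (n : ℝ) * a ^ (n - 1) * (b - a) ^ 2 := by positivity
    have h3 : (n : ℝ) * a ^ (n - 1) * a = n * a ^ n := by
      rcases n with _ | n
      · simp
      · simp [pow_succ, mul_assoc]
    simp only [Nat.add_sub_cancel, Nat.cast_add, Nat.cast_one, pow_succ]
    have h4 : (b - a) * ((n : ℝ) * a ^ (n - 1) * a) = (b - a) * (n * a ^ n) := by rw [h3]
    nlinarith

theorem aux_nonneg (f : Polynomial ℝ) (hf : ∀ n, 0 ≤ f.coeff n) (a : ℝ) (ha : 0 ≤ a) :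
    0 ≤ f.eval a := by
  rw [Polynomial.eval_eq_sum_range]
  exact Finset.sum_nonneg fun i _ => mul_nonneg (hf i) (pow_nonneg ha i)

theorem aux_mono (f : Polynomial ℝ) (hf : ∀ n, 0 ≤ f.coeff n) (a b : ℝ) (ha : 0 ≤ a)
    (hab : a ≤ b) : f.eval a ≤ f.eval b := by
  rw [Polynomial.eval_eq_sum_range, Polynomial.eval_eq_sum_range]
  exact Finset.sum_le_sum fun i _ =>
    mul_le_mul_of_nonneg_left (pow_le_pow_left₀ ha hab i) (hf i)

theorem aux_tangent (f : Polynomial ℝ) (hf : ∀ n, 0 ≤ f.coeff n) (a b : ℝ) (ha : 0 ≤ a)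
    (hb : 0 ≤ b) : f.eval a + (b - a) * f.derivative.eval a ≤ f.eval b := by
  rw [Polynomial.derivative_eval, Polynomial.sum_over_range _ (by simp),
    Polynomial.eval_eq_sum_range, Polynomial.eval_eq_sum_range, Finset.mul_sum,
    ← Finset.sum_add_distrib]
  refine Finset.sum_le_sum fun i _ => ?_
  have := mul_le_mul_of_nonneg_left (aux_pow a b ha hb i) (hf i)
  linarith

/-- For the coupled density-evolution sequences
`x₀ = y₀ = 1`, `x_{i+1} = p·λ(1-ρ(1-x_i))`,
`y_{i+1} = λ(1-ρ(1-x_i)) + p·(ρ(1-x_i) - ρ(1-y_i))·λ'(1-ρ(1-x_i))`,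
one has `x_i ≤ y_i ≤ 1` for all `i`. -/
theorem de_x_le_y_le_one
    (lam rho : Polynomial ℝ)
    (hlam_nonneg : ∀ n, 0 ≤ lam.coeff n)
    (hrho_nonneg : ∀ n, 0 ≤ rho.coeff n)
    (hlam0 : lam.eval 0 = 0) (hlam1 : lam.eval 1 = 1)
    (hrho0 : rho.eval 0 = 0) (hrho1 : rho.eval 1 = 1)
    (p : ℝ) (hp : p ∈ Set.Ioc (0:ℝ) 1)
    (x y : ℕ → ℝ) (hx0 : x 0 = 1) (hy0 : y 0 = 1)
    (hx : ∀ i, x (i + 1) = p * lam.eval (1 - rho.eval (1 - x i)))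
    (hy : ∀ i, y (i + 1) =
      lam.eval (1 - rho.eval (1 - x i))
        + p * (rho.eval (1 - x i) - rho.eval (1 - y i))
            * lam.derivative.eval (1 - rho.eval (1 - x i))) :
    ∀ i, x i ≤ y i ∧ y i ≤ 1 := by
  have hdn : ∀ n, 0 ≤ lam.derivative.coeff n := fun n => by
    rw [Polynomial.coeff_derivative]
    exact mul_nonneg (hlam_nonneg _) (by positivity)
  obtain ⟨hp0, hp1⟩ := hp
  have key : ∀ i, 0 ≤ x i ∧ x i ≤ y i ∧ y i ≤ 1 := by
    intro i
    induction i with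
    | zero => simp [hx0, hy0]
    | succ i ih =>
      obtain ⟨h0, h1, h2⟩ := ih
      have r1 := aux_mono rho hrho_nonneg (1 - y i) (1 - x i) (by linarith) (by linarith)
      have r2 := aux_mono rho hrho_nonneg (1 - x i) 1 (by linarith) (by linarith)
      have r3 := aux_nonneg rho hrho_nonneg (1 - y i) (by linarith)
      rw [hx, hy]
      generalize rho.eval (1 - x i) = u at *
      generalize rho.eval (1 - y i) = v at *
      have l1 := aux_nonneg lam hlam_nonneg (1 - u) (by linarith)
      have l2 := aux_nonneg _ hdn (1 - u) (by linarith)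
      have l3 := aux_tangent lam hlam_nonneg (1 - u) (1 - v) (by linarith) (by linarith)
      have l4 := aux_mono lam hlam_nonneg (1 - v) 1 (by linarith) (by linarith)
      have e1 := mul_nonneg (sub_nonneg.2 r1) l2
      have e2 := mul_nonneg hp0.le e1
      have e3 := mul_nonneg (sub_nonneg.2 hp1) e1
      have e4 := mul_nonneg (sub_nonneg.2 hp1) l1
      refine ⟨mul_nonneg hp0.le l1, ?_, ?_⟩ <;> nlinarith
  exact fun i => (key i).2
end

section
/- (Theorem 1, analytic core) Let λ and ρ be degree-distribution polynomials and let p ∈ (0,1] satisfy p·λ(1−ρ(1−x)) < x for all x ∈ (0,1] and p·λ′(0)·ρ′(1) < 1. Define the coupled sequences x₀ = y₀ = 1, x_{i+1} = p·λ(1−ρ(1−x_i)), and y_{i+1} = λ(1−ρ(1−x_i)) + p·(ρ(1−x_i) − ρ(1−y_i))·λ′(1−ρ(1−x_i)). Then lim_{i→∞} y_i = 0 (and consequently lim_{i→∞} x_i = 0). -/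
theorem aux_mono_s3 (u v : ℝ) (hu : 0 ≤ u) (hv : 0 ≤ v) (n : ℕ) :
    u ^ n + (v - u) * (n * u ^ (n - 1)) ≤ v ^ n := by
  induction n with
  | zero => simp
  | succ n ih =>
    have h1 := mul_le_mul_of_nonneg_left ih hv
    rcases n with _ | n
    · simp
    · simp only [Nat.add_sub_cancel] at *
      have h2 : 0 ≤ (v - u) ^ 2 * (((n + 1 : ℕ) : ℝ) * u ^ n) := by positivity
      have e1 : v ^ (n + 1 + 1) = v * v ^ (n + 1) := by ring
      rw [e1]
      refine le_trans ?_ h1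
      push_cast at *
      ring_nf at *
      linarith

theorem aux_tangent_s3 (q : Polynomial ℝ) (hq : ∀ n, 0 ≤ q.coeff n) (u v : ℝ)
    (hu : 0 ≤ u) (hv : 0 ≤ v) :
    q.eval u + (v - u) * q.derivative.eval u ≤ q.eval v := by
  rw [Polynomial.derivative_eval, Polynomial.eval_eq_sum, Polynomial.eval_eq_sum,
    Polynomial.sum_def, Polynomial.sum_def, Polynomial.sum_def, Finset.mul_sum,
    ← Finset.sum_add_distrib]
  refine Finset.sum_le_sum fun n _ => ?_
  have := mul_le_mul_of_nonneg_left (aux_mono_s3 u v hu hv n) (hq n)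
  linarith

theorem aux_deriv (q : Polynomial ℝ) (hq : ∀ n, 0 ≤ q.coeff n) (u : ℝ) (hu : 0 ≤ u) :
    0 ≤ q.derivative.eval u := by
  rw [Polynomial.derivative_eval, Polynomial.sum_def]
  refine Finset.sum_nonneg fun n _ => ?_
  have := hq n
  positivity

theorem aux_le (q : Polynomial ℝ) (hq : ∀ n, 0 ≤ q.coeff n) (u v : ℝ) (hu : 0 ≤ u)
    (huv : u ≤ v) : q.eval u ≤ q.eval v := by
  have h1 := aux_tangent_s3 q hq u v hu (hu.trans huv)
  have h2 := mul_nonneg (sub_nonneg.2 huv) (aux_deriv q hq u hu)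
  linarith

theorem aux_lim (y a b : ℕ → ℝ) (c : ℝ) (hc : c < 1) (hy : ∀ i, 0 ≤ y i)
    (ha : Filter.Tendsto a Filter.atTop (nhds 0)) (hb : Filter.Tendsto b Filter.atTop (nhds c))
    (hc0 : 0 ≤ c)
    (h : ∀ i, y (i + 1) ≤ a i + b i * y i) : Filter.Tendsto y Filter.atTop (nhds 0) := by
  obtain ⟨d, hcd, hd1⟩ := exists_between hc
  have hd0 : 0 ≤ d := hc0.trans hcd.le
  rw [Metric.tendsto_atTop]
  intro ε hε
  have hpos : 0 < ε / 2 * (1 - d) := mul_pos (by linarith) (by linarith)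
  obtain ⟨N, hN⟩ := Filter.eventually_atTop.1
    ((ha.eventually (gt_mem_nhds hpos)).and (hb.eventually (gt_mem_nhds hcd)))
  have key : ∀ k, y (N + k) - ε / 2 ≤ d ^ k * y N := by
    intro k
    induction k with
    | zero => simp; linarith
    | succ k ih =>
      obtain ⟨h1, h2⟩ := hN (N + k) (by omega)
      have h3 := h (N + k)
      have h4 := mul_le_mul_of_nonneg_right h2.le (hy (N + k))
      have h5 := mul_le_mul_of_nonneg_left ih hd0
      rw [← add_assoc, pow_succ]
      linarith
  have ht : Filter.Tendsto (fun k => d ^ k * y N) Filter.atTop (nhds 0) := by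
    simpa using (tendsto_pow_atTop_nhds_zero_of_lt_one hd0 hd1).mul_const (y N)
  obtain ⟨K, hK⟩ := Filter.eventually_atTop.1
    (ht.eventually (gt_mem_nhds (show 0 < ε / 2 by linarith)))
  refine ⟨N + K, fun n hn => ?_⟩
  have h1 := key (n - N)
  have h2 := hK (n - N) (by omega)
  rw [show N + (n - N) = n by omega] at h1
  rw [Real.dist_eq, sub_zero, abs_of_nonneg (hy n)]
  linarith

/-- **Theorem 1, analytic core.** Below threshold and under the
stability condition, both coupled density-evolution sequences converge to `0`:
the unverified-message probability `y_i → 0`, and consequently `x_i → 0`. -/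
theorem de_y_tendsto_zero
    (lam rho : Polynomial ℝ)
    (hlam_nonneg : ∀ n, 0 ≤ lam.coeff n)
    (hrho_nonneg : ∀ n, 0 ≤ rho.coeff n)
    (hlam0 : lam.eval 0 = 0) (hlam1 : lam.eval 1 = 1)
    (hrho0 : rho.eval 0 = 0) (hrho1 : rho.eval 1 = 1)
    (p : ℝ) (hp : p ∈ Set.Ioc (0:ℝ) 1)
    (hthresh : ∀ t ∈ Set.Ioc (0:ℝ) 1, p * lam.eval (1 - rho.eval (1 - t)) < t)
    (hstab : p * lam.derivative.eval 0 * rho.derivative.eval 1 < 1)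
    (x y : ℕ → ℝ) (hx0 : x 0 = 1) (hy0 : y 0 = 1)
    (hx : ∀ i, x (i + 1) = p * lam.eval (1 - rho.eval (1 - x i)))
    (hy : ∀ i, y (i + 1) =
      lam.eval (1 - rho.eval (1 - x i))
        + p * (rho.eval (1 - x i) - rho.eval (1 - y i))
            * lam.derivative.eval (1 - rho.eval (1 - x i))) :
    Filter.Tendsto y Filter.atTop (nhds 0) ∧
      Filter.Tendsto x Filter.atTop (nhds 0) := by
  obtain ⟨hp0, hp1⟩ := hp
  have hu : ∀ t, 0 ≤ t → t ≤ 1 →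
      0 ≤ 1 - rho.eval (1 - t) ∧ 1 - rho.eval (1 - t) ≤ 1 := by
    intro t h0 h1
    have h2 := aux_le rho hrho_nonneg (1 - t) 1 (by linarith) (by linarith)
    have h3 := aux_le rho hrho_nonneg 0 (1 - t) le_rfl (by linarith)
    constructor <;> linarith
  have hl : ∀ t, 0 ≤ t → 0 ≤ lam.eval t := by
    intro t h0
    have := aux_le lam hlam_nonneg 0 t le_rfl h0
    linarith
  have inv : ∀ i, 0 ≤ x i ∧ x i ≤ y i ∧ y i ≤ 1 := by
    intro i
    induction i with
    | zero => simp [hx0, hy0]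
    | succ i ih =>
      obtain ⟨h1, h2, h3⟩ := ih
      obtain ⟨u0, u1⟩ := hu (x i) h1 (h2.trans h3)
      obtain ⟨v0, v1⟩ := hu (y i) (h1.trans h2) h3
      have huv := aux_le rho hrho_nonneg (1 - y i) (1 - x i) (by linarith) (by linarith)
      rw [hx, hy]
      have hL := hl _ u0
      have hD := aux_deriv lam hlam_nonneg _ u0
      have hT := aux_tangent_s3 lam hlam_nonneg _ _ u0 v0
      have hM := aux_le lam hlam_nonneg _ 1 v0 v1
      set A := rho.eval (1 - x i)
      set B := rho.eval (1 - y i)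
      have hQ : 0 ≤ (A - B) * lam.derivative.eval (1 - A) := mul_nonneg (by linarith) hD
      have hQ1 := mul_nonneg hp0.le hQ
      have hQ2 := mul_le_mul_of_nonneg_right hp1 hQ
      have hL2 := mul_le_mul_of_nonneg_right hp1 hL
      refine ⟨mul_nonneg hp0.le hL, by linarith, by linarith⟩
  have hanti : Antitone x := by
    refine antitone_nat_of_succ_le fun i => ?_
    obtain ⟨h1, h2, h3⟩ := inv i
    rcases h1.eq_or_lt with h | h
    · rw [hx, ← h]; simp [hrho1, hlam0]
    · rw [hx]; exact (hthresh _ ⟨h, h2.trans h3⟩).le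
  have hlim := tendsto_atTop_ciInf hanti ⟨0, by rintro _ ⟨i, rfl⟩; exact (inv i).1⟩
  set L := ⨅ i, x i with hLdef
  have hcu : Continuous fun t : ℝ => 1 - rho.eval (1 - t) := by fun_prop
  have hcf : Continuous fun t : ℝ => p * lam.eval (1 - rho.eval (1 - t)) := by fun_prop
  have hL0 : 0 ≤ L := ge_of_tendsto' hlim fun i => (inv i).1
  have hL1 : L ≤ 1 := le_of_tendsto' hlim fun i => (inv i).2.1.trans (inv i).2.2
  have hfix : L = p * lam.eval (1 - rho.eval (1 - L)) := by
    refine tendsto_nhds_unique ((Filter.tendsto_add_atTop_iff_nat 1).2 hlim) ?_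
    refine ((hcf.tendsto L).comp hlim).congr fun i => ?_
    simp [hx]
  have hLz : L = 0 := by
    rcases hL0.eq_or_lt with h | h
    · exact h.symm
    · exact absurd hfix (hthresh L ⟨h, hL1⟩).ne'
  rw [hLz] at hlim
  refine ⟨?_, hlim⟩
  have hul : Filter.Tendsto (fun i => 1 - rho.eval (1 - x i)) Filter.atTop (nhds 0) := by
    have := (hcu.tendsto 0).comp hlim
    simpa [hrho1, Function.comp_def] using this
  have ha : Filter.Tendsto (fun i => lam.eval (1 - rho.eval (1 - x i)))
      Filter.atTop (nhds 0) := by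
    have := (lam.continuous.tendsto 0).comp hul
    rwa [hlam0] at this
  have hb : Filter.Tendsto (fun i => p * lam.derivative.eval (1 - rho.eval (1 - x i))
      * rho.derivative.eval 1) Filter.atTop
      (nhds (p * lam.derivative.eval 0 * rho.derivative.eval 1)) :=
    (((lam.derivative.continuous.tendsto 0).comp hul).const_mul p).mul_const _
  refine aux_lim y _ _ _ hstab (fun i => (inv i).1.trans (inv i).2.1) ha hb ?_ fun i => ?_
  · exact mul_nonneg (mul_nonneg hp0.le (aux_deriv lam hlam_nonneg 0 le_rfl))
      (aux_deriv rho hrho_nonneg 1 zero_le_one)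
  · obtain ⟨h1, h2, h3⟩ := inv i
    obtain ⟨u0, u1⟩ := hu (x i) h1 (h2.trans h3)
    have hT := aux_tangent_s3 rho hrho_nonneg 1 (1 - y i) zero_le_one (by linarith)
    have hD := mul_nonneg hp0.le (aux_deriv lam hlam_nonneg _ u0)
    rw [hy]
    have := mul_le_mul_of_nonneg_left (show rho.eval (1 - x i) - rho.eval (1 - y i)
      ≤ rho.derivative.eval 1 * y i by linarith) hD
    linarith
end

section
/- (Corollary 1, threshold claim) Let ε ∈ (0,1), let ρ(x) = (1−ε)x + εx², and let p = 1 − ε/(1+ε). Then for all x ∈ (0,1], p·(1 − ρ(1−x)) < x. Consequently, the ensemble with λ(x) = x and ρ(x) = (1−ε)x + εx² has density-evolution threshold at least 1 − ε/(1+ε). -/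
/-- **Corollary 1, threshold claim.** For `ε ∈ (0,1)`,
`ρ(x) = (1-ε)x + εx²` and `p = 1 - ε/(1+ε)`, one has `p·(1-ρ(1-x)) < x` for all
`x ∈ (0,1]`; consequently the ensemble `λ(x)=x`, `ρ(x)=(1-ε)x+εx²` has
density-evolution threshold at least `1 - ε/(1+ε)`. -/
theorem low_rate_ensemble_threshold
    (ε : ℝ) (hε : ε ∈ Set.Ioo (0:ℝ) 1)
    (rho : ℝ → ℝ) (hrho : ∀ t, rho t = (1 - ε) * t + ε * t ^ 2)
    (p : ℝ) (hp : p = 1 - ε / (1 + ε)) :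
    (∀ x ∈ Set.Ioc (0:ℝ) 1, p * (1 - rho (1 - x)) < x) ∧
      p ≤ sSup {p' : ℝ | p' ∈ Set.Ioc (0:ℝ) 1 ∧
        ∀ x ∈ Set.Ioc (0:ℝ) 1, p' * (1 - rho (1 - x)) < x} := by
  obtain ⟨h0, h1⟩ := hε
  have hpos : (0:ℝ) < 1 + ε := by linarith
  have hp' : p = 1 / (1 + ε) := by
    rw [hp]
    field_simp
    ring
  have hp0 : 0 < p := by
    rw [hp']
    positivity
  have hmul : p * (1 + ε) = 1 := by
    rw [hp']
    field_simp
  have key : ∀ x ∈ Set.Ioc (0:ℝ) 1, p * (1 - rho (1 - x)) < x := by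
    rintro x ⟨hx0, _⟩
    have e : p * (1 - rho (1 - x)) = (p * (1 + ε)) * x - p * ε * x ^ 2 := by
      rw [hrho]
      ring
    have hq : 0 < p * ε * x ^ 2 := by positivity
    rw [e, hmul]
    linarith
  refine ⟨key, le_csSup ⟨1, fun q hq => hq.1.2⟩ ⟨⟨hp0, ?_⟩, key⟩⟩
  nlinarith [mul_pos hp0 h0]
end

section
/- (Stability condition for the density-evolution recursion) Let λ and ρ be degree-distribution polynomials and let p ∈ (0,1]. Define f(x) = p·λ(1−ρ(1−x)). If p·λ′(0)·ρ′(1) < 1, then there exist δ > 0 and β ∈ (0,1) such that f(x) ≤ β·x for all x ∈ [0,δ]; consequently, every sequence defined by x_{i+1} = f(x_i) with x₀ ∈ [0,δ] satisfies x_i ≤ β^i·δ for all i and converges to 0. -/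
theorem aux_nonneg_s11 (q : Polynomial ℝ) (h : ∀ n, 0 ≤ q.coeff n) (s : ℝ) (hs : 0 ≤ s) :
    0 ≤ q.eval s := by
  rw [Polynomial.eval_eq_sum_range]
  exact Finset.sum_nonneg fun i _ => mul_nonneg (h i) (pow_nonneg hs i)

theorem aux_le_s11 (q : Polynomial ℝ) (h : ∀ n, 0 ≤ q.coeff n) (s : ℝ) (hs : 0 ≤ s)
    (hs1 : s ≤ 1) : q.eval s ≤ q.eval 1 := by
  rw [Polynomial.eval_eq_sum_range, Polynomial.eval_eq_sum_range]
  exact Finset.sum_le_sum fun i _ =>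
    mul_le_mul_of_nonneg_left (pow_le_pow_left₀ hs hs1 i) (h i)

theorem aux_deriv_nonneg (q : Polynomial ℝ) (h : ∀ n, 0 ≤ q.coeff n) (n : ℕ) :
    0 ≤ q.derivative.coeff n := by
  rw [Polynomial.coeff_derivative]
  exact mul_nonneg (h _) (by positivity)

/-- **stability condition.** If `p·λ'(0)·ρ'(1) < 1`, then there
exist `δ > 0` and `β ∈ (0,1)` with `f(x) ≤ β·x` on `[0,δ]` for
`f(x) = p·λ(1-ρ(1-x))`; consequently every density-evolution sequence started
in `[0,δ]` satisfies `x_i ≤ β^i·δ` and converges to `0`. -/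
theorem de_stability_condition
    (lam rho : Polynomial ℝ)
    (hlam_nonneg : ∀ n, 0 ≤ lam.coeff n)
    (hrho_nonneg : ∀ n, 0 ≤ rho.coeff n)
    (hlam0 : lam.eval 0 = 0) (hlam1 : lam.eval 1 = 1)
    (hrho0 : rho.eval 0 = 0) (hrho1 : rho.eval 1 = 1)
    (p : ℝ) (hp : p ∈ Set.Ioc (0:ℝ) 1)
    (f : ℝ → ℝ) (hf : ∀ t, f t = p * lam.eval (1 - rho.eval (1 - t)))
    (hstab : p * lam.derivative.eval 0 * rho.derivative.eval 1 < 1) :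
    ∃ δ > (0:ℝ), ∃ β ∈ Set.Ioo (0:ℝ) 1,
      (∀ t ∈ Set.Icc (0:ℝ) δ, f t ≤ β * t) ∧
      ∀ x : ℕ → ℝ, x 0 ∈ Set.Icc (0:ℝ) δ → (∀ i, x (i + 1) = f (x i)) →
        (∀ i, x i ≤ β ^ i * δ) ∧ Filter.Tendsto x Filter.atTop (nhds 0) := by
  obtain ⟨hp0, hp1⟩ := hp
  set c := p * lam.derivative.eval 0 * rho.derivative.eval 1 with hc
  have hc0 : 0 ≤ c := mul_nonneg (mul_nonneg hp0.le
    (aux_nonneg_s11 _ (aux_deriv_nonneg _ hlam_nonneg) _ le_rfl))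
    (aux_nonneg_s11 _ (aux_deriv_nonneg _ hrho_nonneg) _ zero_le_one)
  have hf0 : f 0 = 0 := by rw [hf]; simp [hrho1, hlam0]
  have hd : HasDerivAt f c 0 := by
    have h1 : HasDerivAt (fun t : ℝ => 1 - t) (-1) 0 := by
      simpa using (hasDerivAt_id (0:ℝ)).const_sub 1
    have h2 : HasDerivAt (fun t : ℝ => rho.eval (1 - t)) (rho.derivative.eval 1 * -1) 0 := by
      refine HasDerivAt.comp (0:ℝ) (h₂ := fun y => rho.eval y) ?_ h1
      simpa using rho.hasDerivAt (1:ℝ)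
    have h3 := h2.const_sub 1
    have h4 : HasDerivAt (fun t : ℝ => lam.eval (1 - rho.eval (1 - t)))
        (lam.derivative.eval 0 * -(rho.derivative.eval 1 * -1)) 0 := by
      refine HasDerivAt.comp (0:ℝ) (h₂ := fun y => lam.eval y) ?_ h3
      simpa [hrho1] using lam.hasDerivAt (0:ℝ)
    have h5 := h4.const_mul p
    have hfe : f = fun t => p * lam.eval (1 - rho.eval (1 - t)) := funext hf
    rw [hfe]
    exact h5.congr_deriv (by rw [hc]; ring)
  set β := (1 + c) / 2 with hβ
  have hβ0 : 0 < β := by rw [hβ]; linarith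
  have hβ1 : β < 1 := by rw [hβ]; linarith
  have hcβ : c < β := by rw [hβ]; linarith
  have hev := (hasDerivAt_iff_tendsto_slope.1 hd).eventually (gt_mem_nhds hcβ)
  rw [eventually_nhdsWithin_iff, Metric.eventually_nhds_iff] at hev
  obtain ⟨ε, hε, hE⟩ := hev
  have hδ : 0 < min (ε / 2) 1 := by positivity
  have hle : ∀ t ∈ Set.Icc (0:ℝ) (min (ε / 2) 1), f t ≤ β * t := by
    rintro t ⟨h0, h1⟩
    rcases h0.eq_or_lt with rfl | h0
    · simp [hf0]
    · have h2 : t ≤ ε / 2 := h1.trans (min_le_left _ _)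
      have h3 := hE (y := t) (by rw [Real.dist_eq, sub_zero, abs_of_pos h0]; linarith) h0.ne'
      rw [slope_def_field, hf0, sub_zero, sub_zero, div_lt_iff₀ h0] at h3
      exact h3.le
  have hnn : ∀ t ∈ Set.Icc (0:ℝ) (min (ε / 2) 1), 0 ≤ f t := by
    rintro t ⟨h0, h1⟩
    have h2 : t ≤ 1 := h1.trans (min_le_right _ _)
    rw [hf]
    refine mul_nonneg hp0.le (aux_nonneg_s11 _ hlam_nonneg _ ?_)
    have := aux_le_s11 rho hrho_nonneg (1 - t) (by linarith) (by linarith)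
    linarith
  refine ⟨min (ε / 2) 1, hδ, β, ⟨hβ0, hβ1⟩, hle, fun x hx0 hx => ?_⟩
  generalize min (ε / 2) 1 = δ at *
  have key : ∀ i, 0 ≤ x i ∧ x i ≤ β ^ i * δ := by
    intro i
    induction i with
    | zero => simpa using hx0
    | succ k ih =>
      have hm : x k ∈ Set.Icc (0:ℝ) δ :=
        ⟨ih.1, ih.2.trans (mul_le_of_le_one_left hδ.le (pow_le_one₀ hβ0.le hβ1.le))⟩
      rw [hx]
      refine ⟨hnn _ hm, (hle _ hm).trans ?_⟩
      rw [pow_succ', mul_assoc]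
      exact mul_le_mul_of_nonneg_left ih.2 hβ0.le
  refine ⟨fun i => (key i).2, ?_⟩
  refine squeeze_zero (fun i => (key i).1) (fun i => (key i).2) ?_
  simpa using (tendsto_pow_atTop_nhds_zero_of_lt_one hβ0.le hβ1).mul_const δ
end
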